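/- Let u, v : ℂ → ℂ be differentiable (holomorphic on all of ℂ) functions satisfying the Airy equation u''(x) = x·u(x) and v''(x) = x·v(x) for all x ∈ ℂ. Then for every j with 0 ≤ j ≤ 4, the function w := u^j·v^{4−j} satisfies the fifth-order equation w⁽⁵⁾(x) − 20·x·w'''(x) − 30·w''(x) + 64·x²·w'(x) + 64·x·w(x) = 0 for all x ∈ ℂ. (This expresses that the operator ∂⁵ − 20t∂³ − 30∂² + 64t²∂ + 64t is the fourth symmetric power sym⁴(∂² − t) of the Airy operator.) -/

import Mathlib

/-- The first component `e₀` of a solution of the linear system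
`eₖ' = (5 - k) x eₖ₋₁ + (k + 1) eₖ₊₁`, `0 ≤ k ≤ 4`, solves the fourth symmetric power of the
Airy equation. -/
theorem symPow_four_airy_of_system {e₀ e₁ e₂ e₃ e₄ : ℂ → ℂ}
    (h₀ : ∀ x, HasDerivAt e₀ (e₁ x) x)
    (h₁ : ∀ x, HasDerivAt e₁ (4 * x * e₀ x + 2 * e₂ x) x)
    (h₂ : ∀ x, HasDerivAt e₂ (3 * x * e₁ x + 3 * e₃ x) x)
    (h₃ : ∀ x, HasDerivAt e₃ (2 * x * e₂ x + 4 * e₄ x) x)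
    (h₄ : ∀ x, HasDerivAt e₄ (x * e₃ x) x) (x : ℂ) :
    iteratedDeriv 5 e₀ x - 20 * x * iteratedDeriv 3 e₀ x - 30 * iteratedDeriv 2 e₀ x
      + 64 * x ^ 2 * deriv e₀ x + 64 * x * e₀ x = 0 := by
  have d₁ : deriv e₀ = e₁ := funext fun x => (h₀ x).deriv
  have d₂ : iteratedDeriv 2 e₀ = fun x => 4 * x * e₀ x + 2 * e₂ x := by
    rw [iteratedDeriv_succ, iteratedDeriv_one, d₁]
    exact funext fun x => (h₁ x).deriv
  have d₃ : iteratedDeriv 3 e₀ = fun x => 4 * e₀ x + 10 * x * e₁ x + 6 * e₃ x := by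
    rw [iteratedDeriv_succ, d₂]
    refine funext fun x => HasDerivAt.deriv ?_
    convert (((hasDerivAt_id' x).const_mul 4).fun_mul (h₀ x)).fun_add ((h₂ x).const_mul 2) using 1
    ring
  have d₄ : iteratedDeriv 4 e₀ =
      fun x => 14 * e₁ x + 40 * x ^ 2 * e₀ x + 32 * x * e₂ x + 24 * e₄ x := by
    rw [iteratedDeriv_succ, d₃]
    refine funext fun x => HasDerivAt.deriv ?_
    convert (((h₀ x).const_mul 4).fun_add
      (((hasDerivAt_id' x).const_mul 10).fun_mul (h₁ x))).fun_add ((h₃ x).const_mul 6) using 1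
    ring
  have d₅ : iteratedDeriv 5 e₀ =
      fun x => 136 * x * e₀ x + 136 * x ^ 2 * e₁ x + 60 * e₂ x + 120 * x * e₃ x := by
    rw [iteratedDeriv_succ, d₄]
    refine funext fun x => HasDerivAt.deriv ?_
    convert ((((h₁ x).const_mul 14).fun_add
      ((((hasDerivAt_id' x).fun_pow 2).const_mul 40).fun_mul (h₀ x))).fun_add
      (((hasDerivAt_id' x).const_mul 32).fun_mul (h₂ x))).fun_add ((h₄ x).const_mul 24) using 1
    push_cast
    ring
  rw [d₅, d₃, d₂, d₁]
  ring

/-- The product of four solutions of the Airy equation solves its fourth symmetric power. -/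
theorem symPow_four_airy_mul {w a b c d a' b' c' d' : ℂ → ℂ}
    (ha : ∀ x, HasDerivAt a (a' x) x) (ha' : ∀ x, HasDerivAt a' (x * a x) x)
    (hb : ∀ x, HasDerivAt b (b' x) x) (hb' : ∀ x, HasDerivAt b' (x * b x) x)
    (hc : ∀ x, HasDerivAt c (c' x) x) (hc' : ∀ x, HasDerivAt c' (x * c x) x)
    (hd : ∀ x, HasDerivAt d (d' x) x) (hd' : ∀ x, HasDerivAt d' (x * d x) x)
    (hw : ∀ x, w x = a x * b x * c x * d x) (x : ℂ) :
    iteratedDeriv 5 w x - 20 * x * iteratedDeriv 3 w x - 30 * iteratedDeriv 2 w x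
      + 64 * x ^ 2 * deriv w x + 64 * x * w x = 0 := by
  obtain rfl : w = fun z => a z * b z * c z * d z := funext hw
  have mul₄ {p q r s : ℂ → ℂ} {p' q' r' s' x : ℂ} (hp : HasDerivAt p p' x)
      (hq : HasDerivAt q q' x) (hr : HasDerivAt r r' x) (hs : HasDerivAt s s' x) :
      HasDerivAt (fun z => p z * q z * r z * s z)
        (((p' * q x + p x * q') * r x + p x * q x * r') * s x + p x * q x * r x * s') x :=
    ((hp.fun_mul hq).fun_mul hr).fun_mul hs
  refine symPow_four_airy_of_system
    (e₁ := fun z => a' z * b z * c z * d z + a z * b' z * c z * d z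
      + a z * b z * c' z * d z + a z * b z * c z * d' z)
    (e₂ := fun z => a' z * b' z * c z * d z + a' z * b z * c' z * d z
      + a' z * b z * c z * d' z + a z * b' z * c' z * d z
      + a z * b' z * c z * d' z + a z * b z * c' z * d' z)
    (e₃ := fun z => a z * b' z * c' z * d' z + a' z * b z * c' z * d' z
      + a' z * b' z * c z * d' z + a' z * b' z * c' z * d z)
    (e₄ := fun z => a' z * b' z * c' z * d' z)
    (fun x => ?_) (fun x => ?_) (fun x => ?_) (fun x => ?_) (fun x => ?_) x
  · refine HasDerivAt.congr_deriv (mul₄ (ha x) (hb x) (hc x) (hd x)) ?_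
    ring
  · refine HasDerivAt.congr_deriv ((((mul₄ (ha' x) (hb x) (hc x) (hd x)).fun_add
      (mul₄ (ha x) (hb' x) (hc x) (hd x))).fun_add
      (mul₄ (ha x) (hb x) (hc' x) (hd x))).fun_add
      (mul₄ (ha x) (hb x) (hc x) (hd' x))) ?_
    ring
  · refine HasDerivAt.congr_deriv ((((((mul₄ (ha' x) (hb' x) (hc x) (hd x)).fun_add
      (mul₄ (ha' x) (hb x) (hc' x) (hd x))).fun_add
      (mul₄ (ha' x) (hb x) (hc x) (hd' x))).fun_add
      (mul₄ (ha x) (hb' x) (hc' x) (hd x))).fun_add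
      (mul₄ (ha x) (hb' x) (hc x) (hd' x))).fun_add
      (mul₄ (ha x) (hb x) (hc' x) (hd' x))) ?_
    ring
  · refine HasDerivAt.congr_deriv ((((mul₄ (ha x) (hb' x) (hc' x) (hd' x)).fun_add
      (mul₄ (ha' x) (hb x) (hc' x) (hd' x))).fun_add
      (mul₄ (ha' x) (hb' x) (hc x) (hd' x))).fun_add
      (mul₄ (ha' x) (hb' x) (hc' x) (hd x))) ?_
    ring
  · refine HasDerivAt.congr_deriv (mul₄ (ha' x) (hb' x) (hc' x) (hd' x)) ?_
    ring

/-- The derivative of an entire solution `u` of the Airy equation has derivative `x * u x`. -/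
theorem hasDerivAt_deriv_of_airy {u : ℂ → ℂ} (hu : Differentiable ℂ u)
    (hu' : ∀ x : ℂ, iteratedDeriv 2 u x = x * u x) (x : ℂ) :
    HasDerivAt (deriv u) (x * u x) x := by
  rw [← hu' x, iteratedDeriv_succ, iteratedDeriv_one]
  exact (hu.deriv x).hasDerivAt

/-- If `u`, `v` are entire solutions of the Airy equation `w'' = x w`, then for `0 ≤ j ≤ 4`
the product `w = uʲ v⁴⁻ʲ` satisfies `w⁽⁵⁾ − 20x w''' − 30 w'' + 64x² w' + 64x w = 0`
(i.e. `∂⁵ − 20t∂³ − 30∂² + 64t²∂ + 64t` is the fourth symmetric power of `∂² − t`). -/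
theorem stmt_10 (u v : ℂ → ℂ) (hu : Differentiable ℂ u) (hv : Differentiable ℂ v)
    (hu' : ∀ x : ℂ, iteratedDeriv 2 u x = x * u x)
    (hv' : ∀ x : ℂ, iteratedDeriv 2 v x = x * v x)
    (j : ℕ) (hj : j ≤ 4) :
    ∀ x : ℂ,
      iteratedDeriv 5 (fun z => u z ^ j * v z ^ (4 - j)) x
        - 20 * x * iteratedDeriv 3 (fun z => u z ^ j * v z ^ (4 - j)) x
        - 30 * iteratedDeriv 2 (fun z => u z ^ j * v z ^ (4 - j)) x
        + 64 * x ^ 2 * deriv (fun z => u z ^ j * v z ^ (4 - j)) x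
        + 64 * x * (u x ^ j * v x ^ (4 - j)) = 0 := by
  have u₁ (x : ℂ) := (hu x).hasDerivAt
  have v₁ (x : ℂ) := (hv x).hasDerivAt
  have u₂ := hasDerivAt_deriv_of_airy hu hu'
  have v₂ := hasDerivAt_deriv_of_airy hv hv'
  intro x
  interval_cases j
  · exact symPow_four_airy_mul v₁ v₂ v₁ v₂ v₁ v₂ v₁ v₂ (fun _ => by ring) x
  · exact symPow_four_airy_mul u₁ u₂ v₁ v₂ v₁ v₂ v₁ v₂ (fun _ => by ring) x
  · exact symPow_four_airy_mul u₁ u₂ u₁ u₂ v₁ v₂ v₁ v₂ (fun _ => by ring) x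
  · exact symPow_four_airy_mul u₁ u₂ u₁ u₂ u₁ u₂ v₁ v₂ (fun _ => by ring) x
  · exact symPow_four_airy_mul u₁ u₂ u₁ u₂ u₁ u₂ u₁ u₂ (fun _ => by ring) x
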